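/- arXiv:2402.07237 — 2 statements merged into one kernel-verified Lean document; each statement's English description precedes it below -/
import Mathlib

section
/- Let λ > 0. Then there exist R > 0 and ε ∈ (0,1) such that there is one and only one function u : [0,R] → ℝ which is continuously differentiable on [0,R], twice differentiable on (0,R), satisfies u(0) = u'(0) = 0, sup_{[0,R]}|u| + sup_{[0,R]}|u'| ≤ ε, and satisfies for all r ∈ (0,R): u''(r)/(1−u'(r)²)^{3/2} + u'(r)/(r·√(1−u'(r)²)) = −2(1/√(1−u'(r)²) + λ). (Existence and uniqueness of the radial timelike λ-translator intersecting the spacelike rotation axis orthogonally.) -/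
open Real Set

/-- `u` (with derivative `u'`) is a radial timelike λ-translator profile on `[0,R]`
with `u(0) = u'(0) = 0` and C¹-norm at most `ε`. -/
def IsRadialTimelikeSol (lam R ε : ℝ) (u u' : ℝ → ℝ) : Prop :=
  (∀ r ∈ Icc (0:ℝ) R, HasDerivWithinAt u (u' r) (Icc (0:ℝ) R) r) ∧
  ContinuousOn u' (Icc (0:ℝ) R) ∧
  u 0 = 0 ∧ u' 0 = 0 ∧
  (∀ r ∈ Icc (0:ℝ) R, ∀ s ∈ Icc (0:ℝ) R, |u r| + |u' s| ≤ ε) ∧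
  (∀ r ∈ Ioo (0:ℝ) R, ∃ d2 : ℝ,
    HasDerivAt u' d2 r ∧
    d2 / (1 - u' r ^ 2) ^ ((3:ℝ)/2) + u' r / (r * Real.sqrt (1 - u' r ^ 2)) =
      -2 * (1 / Real.sqrt (1 - u' r ^ 2) + lam))

open intervalIntegral

lemma rpow_three_halves_eq_sqrt_pow {x : ℝ} (hx : 0 ≤ x) : x ^ ((3:ℝ)/2) = √x ^ 3 := by
  rw [Real.sqrt_eq_rpow, ← Real.rpow_mul_natCast hx]
  norm_num

lemma abs_sqrt_one_add_sq_sub_le (a b : ℝ) : |√(1 + a ^ 2) - √(1 + b ^ 2)| ≤ |a - b| := by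
  have ha : 0 < 1 + a ^ 2 := by positivity
  have hb : 0 < 1 + b ^ 2 := by positivity
  have hA := Real.sq_sqrt ha.le
  have hB := Real.sq_sqrt hb.le
  have hA0 := Real.sqrt_pos.2 ha
  have hB0 := Real.sqrt_pos.2 hb
  have key : 1 + a * b ≤ √(1 + a ^ 2) * √(1 + b ^ 2) := by
    rw [← Real.sqrt_mul ha.le]
    exact Real.le_sqrt_of_sq_le (by nlinarith [sq_nonneg (a - b)])
  rw [← sq_le_sq]
  nlinarith

lemma sqrt_one_add_sq_le (a : ℝ) : √(1 + a ^ 2) ≤ 1 + |a| := by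
  rw [Real.sqrt_le_left (by positivity)]
  nlinarith [abs_nonneg a, sq_abs a]

/-- The derivative of the hyperbolic slope `p / √(1 - p²)`. -/
lemma HasDerivAt.div_sqrt_one_sub_sq {p : ℝ → ℝ} {d r : ℝ} (hp : HasDerivAt p d r)
    (h : p r ^ 2 < 1) :
    HasDerivAt (fun s => p s / √(1 - p s ^ 2)) (d / √(1 - p r ^ 2) ^ 3) r := by
  have hpos : 0 < 1 - p r ^ 2 := by linarith
  have hc := Real.sqrt_pos.2 hpos
  have hsq := Real.sq_sqrt hpos.le
  have h1 := hp.div (((hp.pow 2).const_sub 1).sqrt hpos.ne') hc.ne'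
  refine h1.congr_deriv ?_
  simp only [Pi.pow_apply]
  generalize √(1 - p r ^ 2) = c at *
  field_simp
  rw [hsq]
  push_cast
  ring

/-- The derivative of `q / √(1 + q²)`. -/
lemma HasDerivAt.div_sqrt_one_add_sq {q : ℝ → ℝ} {d r : ℝ} (hq : HasDerivAt q d r) :
    HasDerivAt (fun s => q s / √(1 + q s ^ 2)) (d / √(1 + q r ^ 2) ^ 3) r := by
  have hpos : 0 < 1 + q r ^ 2 := by positivity
  have hc := Real.sqrt_pos.2 hpos
  have hsq := Real.sq_sqrt hpos.le
  have h1 := hq.div (((hq.pow 2).const_add 1).sqrt hpos.ne') hc.ne'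
  refine h1.congr_deriv ?_
  simp only [Pi.pow_apply]
  generalize √(1 + q r ^ 2) = c at *
  field_simp
  rw [hsq]
  push_cast
  ring

lemma one_sub_div_sqrt_one_add_sq_sq (q : ℝ) : 1 - (q / √(1 + q ^ 2)) ^ 2 = 1 / (1 + q ^ 2) := by
  have hpos : 0 < 1 + q ^ 2 := by positivity
  rw [div_pow, Real.sq_sqrt hpos.le]
  field_simp
  ring

lemma sqrt_one_add_div_sqrt_one_sub_sq_sq {p : ℝ} (h : p ^ 2 < 1) :
    √(1 + (p / √(1 - p ^ 2)) ^ 2) = 1 / √(1 - p ^ 2) := by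
  have hpos : 0 < 1 - p ^ 2 := by linarith
  rw [div_pow, Real.sq_sqrt hpos.le, ← Real.sqrt_one, ← Real.sqrt_div zero_le_one, Real.sqrt_one]
  congr 1
  field_simp
  ring

lemma injOn_div_sqrt_one_sub_sq : InjOn (fun p : ℝ => p / √(1 - p ^ 2)) {p | p ^ 2 < 1} := by
  intro a ha b hb hab
  have h1 := sqrt_one_add_div_sqrt_one_sub_sq_sq ha
  have h2 := sqrt_one_add_div_sqrt_one_sub_sq_sq hb
  have ha0 : 0 < √(1 - a ^ 2) := Real.sqrt_pos.2 (by simpa using ha)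
  have hb0 : 0 < √(1 - b ^ 2) := Real.sqrt_pos.2 (by simpa using hb)
  simp only at hab
  rw [hab, h2] at h1
  have hc : √(1 - a ^ 2) = √(1 - b ^ 2) := by
    field_simp at h1
    exact h1
  rw [hc] at hab
  field_simp at hab
  exact hab

lemma hasDerivWithinAt_id_mul_zero {f : ℝ → ℝ} {s : Set ℝ} (hf : ContinuousWithinAt f s 0) :
    HasDerivWithinAt (fun r => r * f r) (f 0) s 0 := by
  rw [hasDerivWithinAt_iff_tendsto_slope]
  refine (hf.mono sdiff_subset).tendsto.congr' ?_
  filter_upwards [self_mem_nhdsWithin] with r hr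
  have : r ≠ 0 := hr.2
  simp [slope_def_field, this]

namespace IsRadialTimelikeSol

variable {lam R ε : ℝ} {u u' : ℝ → ℝ}

lemma sq_lt_one (hu : IsRadialTimelikeSol lam R ε u u') (hε : ε < 1) {r : ℝ}
    (hr : r ∈ Icc (0:ℝ) R) : u' r ^ 2 < 1 := by
  have h := hu.2.2.2.2.1 r hr r hr
  rw [sq_lt_one_iff_abs_lt_one]
  linarith [abs_nonneg (u r)]

lemma continuousOn_slope (hu : IsRadialTimelikeSol lam R ε u u') (hε : ε < 1) :
    ContinuousOn (fun s => u' s / √(1 - u' s ^ 2)) (Icc 0 R) := by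
  have hc := hu.2.1
  refine hc.div (by fun_prop) fun r hr => ?_
  exact (Real.sqrt_pos.2 (by linarith [hu.sq_lt_one hε hr])).ne'

/-- The translator equation in divergence form. -/
lemma hasDerivAt_mul_slope (hu : IsRadialTimelikeSol lam R ε u u') (hε : ε < 1) {r : ℝ}
    (hr : r ∈ Ioo (0:ℝ) R) :
    HasDerivAt (fun s => s * (u' s / √(1 - u' s ^ 2)))
      (-2 * r * (√(1 + (u' r / √(1 - u' r ^ 2)) ^ 2) + lam)) r := by
  obtain ⟨d, hd, hode⟩ := hu.2.2.2.2.2 r hr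
  have hlt := hu.sq_lt_one hε (Ioo_subset_Icc_self hr)
  have hc : 0 < √(1 - u' r ^ 2) := Real.sqrt_pos.2 (by linarith)
  rw [sqrt_one_add_div_sqrt_one_sub_sq_sq hlt]
  rw [rpow_three_halves_eq_sqrt_pow (by linarith)] at hode
  refine ((hasDerivAt_id r).mul (hd.div_sqrt_one_sub_sq hlt)).congr_deriv ?_
  have hr0 : r ≠ 0 := hr.1.ne'
  calc _ = r * (d / √(1 - u' r ^ 2) ^ 3 + u' r / (r * √(1 - u' r ^ 2))) := by
        simp only [id]; field_simp; ring
    _ = _ := by rw [hode]; ring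

lemma eqOn_deriv {v v' : ℝ → ℝ} (hu : IsRadialTimelikeSol lam R ε u u')
    (hv : IsRadialTimelikeSol lam R ε v v') (hε : ε < 1) : EqOn u' v' (Icc 0 R) := by
  set p : ℝ → ℝ := fun s => u' s / √(1 - u' s ^ 2) with hp
  set q : ℝ → ℝ := fun s => v' s / √(1 - v' s ^ 2) with hq
  have hpc : ContinuousOn p (Icc 0 R) := hu.continuousOn_slope hε
  have hqc : ContinuousOn q (Icc 0 R) := hv.continuousOn_slope hε
  have hp0 : p 0 = 0 := by simp [hp, hu.2.2.2.1]
  have hq0 : q 0 = 0 := by simp [hq, hv.2.2.2.1]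
  have hzero : ∀ r ∈ Icc 0 R, r * (p r - q r) = 0 := by
    refine eq_zero_of_abs_deriv_le_mul_abs_self_of_eq_zero_right (K := 2)
      (f' := fun r => -2 * r * (√(1 + p r ^ 2) - √(1 + q r ^ 2))) (by fun_prop) ?_ (by simp) ?_
    · intro r hr
      rcases hr.1.eq_or_lt with rfl | h0
      · have := hasDerivWithinAt_id_mul_zero ((hpc.sub hqc) 0 ⟨le_rfl, hr.2.le⟩)
        refine (this.mono_of_mem_nhdsWithin (Icc_mem_nhdsGE hr.2)).congr_deriv ?_
        simp [hp0, hq0]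
      · have h1 := (hu.hasDerivAt_mul_slope hε ⟨h0, hr.2⟩).sub
          (hv.hasDerivAt_mul_slope hε ⟨h0, hr.2⟩)
        refine ((h1.congr_deriv ?_).congr_of_eventuallyEq ?_).hasDerivWithinAt
        · simp only [hp, hq]; ring
        · exact .of_forall fun s => by simp only [hp, hq, Pi.sub_apply]; ring
    · intro r hr
      rw [Real.norm_eq_abs, Real.norm_eq_abs, abs_mul, abs_mul, abs_mul, abs_neg, abs_two,
        ← mul_assoc]
      exact mul_le_mul_of_nonneg_left (abs_sqrt_one_add_sq_sub_le _ _) (by positivity)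
  intro r hr
  rcases hr.1.eq_or_lt with rfl | h0
  · rw [hu.2.2.2.1, hv.2.2.2.1]
  · refine injOn_div_sqrt_one_sub_sq (hu.sq_lt_one hε hr) (hv.sq_lt_one hε hr) ?_
    have := (mul_eq_zero.1 (hzero r hr)).resolve_left h0.ne'
    exact sub_eq_zero.1 this

lemma eqOn {v v' : ℝ → ℝ} (hu : IsRadialTimelikeSol lam R ε u u')
    (hv : IsRadialTimelikeSol lam R ε v v') (hε : ε < 1) : EqOn u v (Icc 0 R) := by
  refine eq_of_has_deriv_right_eq (f' := u') (g := v) ?_ ?_ ?_ ?_ ?_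
  · intro r hr
    exact (hu.1 r (Ico_subset_Icc_self hr)).mono_of_mem_nhdsWithin (Icc_mem_nhdsGE_of_mem hr)
  · intro r hr
    rw [hu.eqOn_deriv hv hε (Ico_subset_Icc_self hr)]
    exact (hv.1 r (Ico_subset_Icc_self hr)).mono_of_mem_nhdsWithin (Icc_mem_nhdsGE_of_mem hr)
  · exact fun r hr => (hu.1 r hr).continuousWithinAt
  · exact fun r hr => (hv.1 r hr).continuousWithinAt
  · rw [hu.2.2.1, hv.2.2.1]

end IsRadialTimelikeSol

/-- The integrated translator equation, as an operator on continuous slopes on `[0,R]`. -/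
noncomputable def slopeOperator (lam R : ℝ) (hR : 0 ≤ R) (f : C(Icc (0:ℝ) R, ℝ)) :
    C(Icc (0:ℝ) R, ℝ) where
  toFun r := -2 * r * ∫ t in (0:ℝ)..1, t * (√(1 + IccExtend hR f (r * t) ^ 2) + lam)
  continuous_toFun := by
    refine (by fun_prop : Continuous fun r : Icc (0:ℝ) R => -2 * (r:ℝ)).mul ?_
    refine continuous_parametric_intervalIntegral_of_continuous' ?_ 0 1
    have : Continuous (IccExtend hR f) := f.continuous.Icc_extend'
    unfold Function.uncurry
    fun_prop

lemma dist_slopeOperator_le {lam R : ℝ} (hR : 0 ≤ R) (f g : C(Icc (0:ℝ) R, ℝ)) :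
    dist (slopeOperator lam R hR f) (slopeOperator lam R hR g) ≤ 2 * R * dist f g := by
  rw [ContinuousMap.dist_le (by positivity)]
  intro r
  have hf : Continuous (IccExtend hR f) := f.continuous.Icc_extend'
  have hg : Continuous (IccExtend hR g) := g.continuous.Icc_extend'
  simp only [slopeOperator, ContinuousMap.coe_mk]
  rw [Real.dist_eq, ← mul_sub, ← integral_sub (Continuous.intervalIntegrable (by fun_prop) _ _)
    (Continuous.intervalIntegrable (by fun_prop) _ _), abs_mul, abs_mul, abs_neg, abs_two,
    abs_of_nonneg r.2.1]
  have hr := r.2.2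
  gcongr
  rw [← Real.norm_eq_abs]
  refine (norm_integral_le_of_norm_le_const (C := dist f g) fun t ht => ?_).trans_eq (by simp)
  rw [uIoc_of_le zero_le_one] at ht
  rw [Real.norm_eq_abs, ← mul_sub, add_sub_add_right_eq_sub, abs_mul, abs_of_pos ht.1]
  refine (mul_le_of_le_one_left (abs_nonneg _) ht.2).trans
    ((abs_sqrt_one_add_sq_sub_le _ _).trans ?_)
  rw [← Real.dist_eq]
  exact ContinuousMap.dist_apply_le_dist _

/-- A continuous slope function solving the integrated translator equation. -/
lemma exists_slope_integral_eq (lam : ℝ) {R : ℝ} (hR : 0 ≤ R) (hR' : R < 1 / 2) :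
    ∃ w : ℝ → ℝ, Continuous w ∧ ∀ r ∈ Icc 0 R,
      w r = -2 * r * ∫ t in (0:ℝ)..1, t * (√(1 + w (r * t) ^ 2) + lam) := by
  have : Nonempty (Icc (0:ℝ) R) := ⟨⟨0, le_rfl, hR⟩⟩
  have hc : ContractingWith (2 * R).toNNReal (slopeOperator lam R hR) := by
    refine ⟨Real.toNNReal_lt_one.2 (by linarith), LipschitzWith.of_dist_le_mul fun f g => ?_⟩
    rw [Real.coe_toNNReal _ (by positivity)]
    exact dist_slopeOperator_le hR f g
  obtain ⟨f, hf⟩ : ∃ f, slopeOperator lam R hR f = f := ⟨_, hc.fixedPoint_isFixedPt⟩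
  refine ⟨IccExtend hR f, f.continuous.Icc_extend', fun r hr => ?_⟩
  rw [IccExtend_of_mem hR f hr]
  conv_lhs => rw [← hf]
  rfl

lemma mul_slope_eq_integral {lam R : ℝ} {w : ℝ → ℝ}
    (hw : ∀ r ∈ Icc 0 R, w r = -2 * r * ∫ t in (0:ℝ)..1, t * (√(1 + w (r * t) ^ 2) + lam))
    {r : ℝ} (hr : r ∈ Icc 0 R) :
    r * w r = -2 * ∫ s in (0:ℝ)..r, s * (√(1 + w s ^ 2) + lam) := by
  have h := mul_integral_comp_mul_left (a := 0) (b := 1)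
    (f := fun s => s * (√(1 + w s ^ 2) + lam)) r
  rw [mul_zero, mul_one] at h
  simp only [mul_assoc] at h
  rw [intervalIntegral.integral_const_mul] at h
  rw [hw r hr, ← h]
  ring

lemma abs_slope_le {lam R : ℝ} (hlam : 0 ≤ lam) (hR : 0 ≤ R) (hR' : R ≤ 1 / 4) {w : ℝ → ℝ}
    (hwc : Continuous w)
    (hw : ∀ r ∈ Icc 0 R, w r = -2 * r * ∫ t in (0:ℝ)..1, t * (√(1 + w (r * t) ^ 2) + lam))
    {r : ℝ} (hr : r ∈ Icc 0 R) : |w r| ≤ 4 * R * (1 + lam) := by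
  obtain ⟨m, hm, hmax⟩ := isCompact_Icc.exists_isMaxOn ⟨0, le_rfl, hR⟩ hwc.abs.continuousOn
  refine (hmax hr).trans ?_
  have hint : |∫ t in (0:ℝ)..1, t * (√(1 + w (m * t) ^ 2) + lam)| ≤ 1 + |w m| + lam := by
    rw [← Real.norm_eq_abs]
    refine (norm_integral_le_of_norm_le_const (C := 1 + |w m| + lam) fun t ht => ?_).trans_eq
      (by simp)
    rw [uIoc_of_le zero_le_one] at ht
    have h0 : 0 ≤ √(1 + w (m * t) ^ 2) + lam := by positivity
    rw [Real.norm_eq_abs, abs_mul, abs_of_pos ht.1, abs_of_nonneg h0]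
    refine (mul_le_of_le_one_left h0 ht.2).trans ?_
    have h1 : |w (m * t)| ≤ |w m| :=
      hmax ⟨mul_nonneg hm.1 ht.1.le, (mul_le_of_le_one_right hm.1 ht.2).trans hm.2⟩
    linarith [sqrt_one_add_sq_le (w (m * t))]
  have h2 : |w m| ≤ 2 * R * (1 + |w m| + lam) := by
    conv_lhs => rw [hw m hm]
    rw [abs_mul, abs_mul, abs_neg, abs_two, abs_of_nonneg hm.1]
    have := hm.2
    gcongr
  nlinarith [abs_nonneg (w m)]

lemma abs_div_sqrt_one_add_sq_le (q : ℝ) : |q / √(1 + q ^ 2)| ≤ |q| := by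
  rw [abs_div, abs_of_nonneg (Real.sqrt_nonneg _)]
  exact div_le_self (abs_nonneg q) (Real.one_le_sqrt.2 (by nlinarith [sq_nonneg q]))

lemma hasDerivAt_slope {lam R : ℝ} {w : ℝ → ℝ} (hwc : Continuous w)
    (hw : ∀ r ∈ Icc 0 R, w r = -2 * r * ∫ t in (0:ℝ)..1, t * (√(1 + w (r * t) ^ 2) + lam))
    {r : ℝ} (hr : r ∈ Ioo 0 R) :
    HasDerivAt w (-2 * (√(1 + w r ^ 2) + lam) - w r / r) r := by
  have hr0 : r ≠ 0 := hr.1.ne'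
  have hcont : Continuous fun s => s * (√(1 + w s ^ 2) + lam) := by fun_prop
  have h1 := ((hcont.integral_hasStrictDerivAt 0 r).hasDerivAt.const_mul (-2)).div
    (hasDerivAt_id r) hr0
  have hmul := mul_slope_eq_integral hw (Ioo_subset_Icc_self hr)
  refine (h1.congr_of_eventuallyEq ?_).congr_deriv ?_
  · filter_upwards [Ioo_mem_nhds hr.1 hr.2] with s hs
    have hs0 : s ≠ 0 := hs.1.ne'
    simp only [Pi.div_apply, id]
    rw [← mul_slope_eq_integral hw (Ioo_subset_Icc_self hs)]
    field_simp
  · rw [← hmul]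
    simp only [id]
    field_simp

lemma exists_isRadialTimelikeSol {lam R : ℝ} (hlam : 0 ≤ lam) (hR : 0 < R)
    (hRlam : 16 * R * (1 + lam) ≤ 1) :
    ∃ u u' : ℝ → ℝ, IsRadialTimelikeSol lam R (1 / 2) u u' := by
  have hR' : R ≤ 1 / 16 := by nlinarith
  obtain ⟨w, hwc, hw⟩ := exists_slope_integral_eq lam hR.le (by linarith)
  have hbound : ∀ r ∈ Icc 0 R, |w r / √(1 + w r ^ 2)| ≤ 1 / 4 := fun r hr => by
    have := abs_slope_le hlam hR.le (by linarith) hwc hw hr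
    linarith [abs_div_sqrt_one_add_sq_le (w r)]
  have hcont : Continuous fun s => w s / √(1 + w s ^ 2) :=
    hwc.div (by fun_prop) fun s => (Real.sqrt_pos.2 (by positivity)).ne'
  have hw0 : w 0 = 0 := by simpa using hw 0 ⟨le_rfl, hR.le⟩
  refine ⟨fun r => ∫ s in (0:ℝ)..r, w s / √(1 + w s ^ 2), fun s => w s / √(1 + w s ^ 2),
    fun r _ => (hcont.integral_hasStrictDerivAt 0 r).hasDerivAt.hasDerivWithinAt,
    hcont.continuousOn, by simp, by simp [hw0], fun r hr s hs => ?_, fun r hr => ?_⟩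
  · have h1 : |∫ s in (0:ℝ)..r, w s / √(1 + w s ^ 2)| ≤ 1 / 4 * |r - 0| := by
      rw [← Real.norm_eq_abs]
      refine norm_integral_le_of_norm_le_const fun t ht => ?_
      rw [uIoc_of_le hr.1] at ht
      exact hbound t ⟨ht.1.le, ht.2.trans hr.2⟩
    rw [sub_zero, abs_of_nonneg hr.1] at h1
    linarith [hbound s hs, hr.2]
  · refine ⟨_, (hasDerivAt_slope hwc hw hr).div_sqrt_one_add_sq, ?_⟩
    have hr0 : r ≠ 0 := hr.1.ne'
    have hpos : 0 < 1 + w r ^ 2 := by positivity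
    have hc := Real.sqrt_pos.2 hpos
    rw [one_sub_div_sqrt_one_add_sq_sq, rpow_three_halves_eq_sqrt_pow (by positivity),
      Real.sqrt_div zero_le_one, Real.sqrt_one]
    field_simp
    ring

/-- Existence and uniqueness of the radial timelike λ-translator intersecting
the spacelike rotation axis orthogonally. -/
theorem exists_unique_radial_timelike_translator (lam : ℝ) (hlam : 0 < lam) :
    ∃ R > (0:ℝ), ∃ ε ∈ Ioo (0:ℝ) 1,
      (∃ u u' : ℝ → ℝ, IsRadialTimelikeSol lam R ε u u') ∧
      (∀ u u' v v' : ℝ → ℝ, IsRadialTimelikeSol lam R ε u u' →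
        IsRadialTimelikeSol lam R ε v v' → EqOn u v (Icc (0:ℝ) R)) := by
  refine ⟨1 / (16 * (1 + lam)), by positivity, 1 / 2, ⟨by norm_num, by norm_num⟩,
    exists_isRadialTimelikeSol hlam.le (by positivity) (le_of_eq ?_),
    fun _ _ _ _ hu hv => hu.eqOn hv (by norm_num)⟩
  field_simp
end

section
/- Let λ > 0, R > 0, and let u : [0,R] → ℝ be continuously differentiable on [0,R] with u(0) = u'(0) = 0 and sup_{[0,R]}|u'| < 1. Then u is twice differentiable on (0,R) and satisfies u''(r)/(1−u'(r)²)^{3/2} + u'(r)/(r·√(1−u'(r)²)) = 2(1/√(1−u'(r)²) − λ) for all r ∈ (0,R) if and only if for all r ∈ [0,R]: u(r) = ∫₀^r f⁻¹( (2/t)·∫₀^t s·φ(u'(s)) ds ) dt, where φ(y) = 1/√(1−y²) − λ and f⁻¹(y) = y/√(1+y²) (with the inner expression understood as 0 at t = 0). -/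
open Real Set

noncomputable def phiTrans (lam y : ℝ) : ℝ := 1 / Real.sqrt (1 - y ^ 2) - lam

noncomputable def fInv (y : ℝ) : ℝ := y / Real.sqrt (1 + y ^ 2)

open intervalIntegral MeasureTheory Topology Filter

/-- The map `y ↦ y / √(1 - y²)`, of which `fInv` is the inverse. -/
noncomputable def fSlope (y : ℝ) : ℝ := y / Real.sqrt (1 - y ^ 2)

lemma one_sub_sq_pos_of_abs_lt_one {y : ℝ} (hy : |y| < 1) : 0 < 1 - y ^ 2 := by
  have := (sq_lt_one_iff_abs_lt_one y).2 hy
  linarith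

lemma fInv_fSlope {y : ℝ} (hy : |y| < 1) : fInv (fSlope y) = y := by
  have h := one_sub_sq_pos_of_abs_lt_one hy
  have hs := Real.sqrt_pos.2 h
  have e : 1 + (y / √(1 - y ^ 2)) ^ 2 = (1 / √(1 - y ^ 2)) ^ 2 := by
    rw [div_pow, div_pow, Real.sq_sqrt h.le]
    field_simp
    ring
  unfold fInv fSlope
  rw [e, Real.sqrt_sq (by positivity)]
  field_simp

lemma fSlope_fInv (z : ℝ) : fSlope (fInv z) = z := by
  have h : 0 < 1 + z ^ 2 := by positivity
  have hs := Real.sqrt_pos.2 h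
  have e : 1 - (z / √(1 + z ^ 2)) ^ 2 = (1 / √(1 + z ^ 2)) ^ 2 := by
    rw [div_pow, div_pow, Real.sq_sqrt h.le]
    field_simp
    ring
  unfold fInv fSlope
  rw [e, Real.sqrt_sq (by positivity)]
  field_simp

lemma rpow_three_halves {x : ℝ} (hx : 0 < x) : x ^ ((3:ℝ)/2) = x * √x := by
  rw [show (3:ℝ)/2 = 1 + 1/2 by norm_num, Real.rpow_add hx, Real.rpow_one,
    ← Real.sqrt_eq_rpow]

lemma hasDerivAt_fSlope {y : ℝ} (hy : |y| < 1) :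
    HasDerivAt fSlope (1 / (1 - y ^ 2) ^ ((3:ℝ)/2)) y := by
  have h := one_sub_sq_pos_of_abs_lt_one hy
  have hs := Real.sqrt_pos.2 h
  have h1 : HasDerivAt (fun y : ℝ => 1 - y ^ 2) (-(2 * y)) y := by
    simpa using (hasDerivAt_pow 2 y).const_sub 1
  refine ((hasDerivAt_id y).div (h1.sqrt h.ne') hs.ne').congr_deriv ?_
  rw [rpow_three_halves h, Real.sq_sqrt h.le]
  simp only [id]
  field_simp
  rw [Real.sq_sqrt h.le]
  ring

lemma differentiable_fInv : Differentiable ℝ fInv := by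
  intro z
  have h : 1 + z ^ 2 ≠ 0 := by positivity
  have hs : √(1 + z ^ 2) ≠ 0 := by positivity
  unfold fInv
  fun_prop (disch := assumption)

lemma abs_fInv_le_one (z : ℝ) : |fInv z| ≤ 1 := by
  have h : 0 < 1 + z ^ 2 := by positivity
  unfold fInv
  rw [abs_div, abs_of_pos (Real.sqrt_pos.2 h), div_le_one (Real.sqrt_pos.2 h)]
  exact Real.abs_le_sqrt (by linarith)

lemma continuousOn_mul_phiTrans {lam : ℝ} {v : ℝ → ℝ} {s : Set ℝ} (hv : ContinuousOn v s)
    (hlt : ∀ r ∈ s, |v r| < 1) : ContinuousOn (fun r => r * phiTrans lam (v r)) s := by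
  unfold phiTrans
  refine continuousOn_id.mul ((continuousOn_const.div ?_ ?_).sub continuousOn_const)
  · fun_prop
  · exact fun r hr => (Real.sqrt_pos.2 (one_sub_sq_pos_of_abs_lt_one (hlt r hr))).ne'

lemma continuousOn_primitive_Icc {g : ℝ → ℝ} {R : ℝ} (hR : 0 ≤ R)
    (hg : ContinuousOn g (Icc 0 R)) :
    ContinuousOn (fun r => ∫ s in (0:ℝ)..r, g s) (Icc 0 R) := by
  have := continuousOn_primitive_interval (μ := volume) (f := g) (a := 0) (b := R)
    (by rw [uIcc_of_le hR]; exact hg.integrableOn_Icc)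
  rwa [uIcc_of_le hR] at this

lemma hasDerivAt_primitive_of_mem_Ioo {g : ℝ → ℝ} {R r : ℝ}
    (hi : IntervalIntegrable g volume 0 r) (hg : ContinuousOn g (Ioo 0 R)) (hr : r ∈ Ioo 0 R) :
    HasDerivAt (fun r => ∫ s in (0:ℝ)..r, g s) (g r) r :=
  integral_hasDerivAt_right hi
    (hg.stronglyMeasurableAtFilter isOpen_Ioo r hr) (hg.continuousAt (isOpen_Ioo.mem_nhds hr))

/-- The pointwise ODE is the divided form of `(r f(v))' = 2 r φ(v)`. -/
lemma ode_iff_mul_eq {lam r y d : ℝ} (hr : 0 < r) (hy : |y| < 1) :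
    d / (1 - y ^ 2) ^ ((3:ℝ)/2) + y / (r * √(1 - y ^ 2)) = 2 * (1 / √(1 - y ^ 2) - lam) ↔
    1 * fSlope y + r * (1 / (1 - y ^ 2) ^ ((3:ℝ)/2) * d) = 2 * (r * phiTrans lam y) := by
  have h := one_sub_sq_pos_of_abs_lt_one hy
  have hs := Real.sqrt_pos.2 h
  rw [← mul_right_inj' hr.ne']
  unfold fSlope phiTrans
  have e1 : r * (d / (1 - y ^ 2) ^ ((3:ℝ)/2) + y / (r * √(1 - y ^ 2))) =
      1 * (y / √(1 - y ^ 2)) + r * (1 / (1 - y ^ 2) ^ ((3:ℝ)/2) * d) := by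
    field_simp
    ring
  have e2 : r * (2 * (1 / √(1 - y ^ 2) - lam)) = 2 * (r * (1 / √(1 - y ^ 2) - lam)) := by ring
  rw [e1, e2]

lemma eq_fInv_of_radial_ODE {lam R : ℝ} (hR : 0 < R) {v : ℝ → ℝ}
    (hv : ContinuousOn v (Icc 0 R)) (hlt : ∀ r ∈ Icc 0 R, |v r| < 1) (h0 : v 0 = 0)
    (hode : ∀ r ∈ Ioo 0 R, ∃ d2 : ℝ, HasDerivAt v d2 r ∧
      d2 / (1 - v r ^ 2) ^ ((3:ℝ)/2) + v r / (r * √(1 - v r ^ 2)) =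
        2 * (1 / √(1 - v r ^ 2) - lam)) {r : ℝ} (hr : r ∈ Icc 0 R) :
    v r = fInv ((2 / r) * ∫ s in (0:ℝ)..r, s * phiTrans lam (v s)) := by
  rcases hr.1.eq_or_lt with rfl | hr0
  · simp [h0, fInv]
  have hg := continuousOn_mul_phiTrans (lam := lam) hv hlt
  have hf : ContinuousOn (fun t => fSlope (v t)) (Icc 0 R) := fun t ht =>
    (hasDerivAt_fSlope (hlt t ht)).continuousAt.comp_continuousWithinAt (hv t ht)
  have hF : ContinuousOn
      (fun t => t * fSlope (v t) - 2 * ∫ s in (0:ℝ)..t, s * phiTrans lam (v s)) (Icc 0 R) :=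
    (continuousOn_id.mul hf).sub (continuousOn_const.mul (continuousOn_primitive_Icc hR.le hg))
  have hd : ∀ t ∈ Ioo 0 r, HasDerivAt
      (fun t => t * fSlope (v t) - 2 * ∫ s in (0:ℝ)..t, s * phiTrans lam (v s)) 0 t := by
    intro t ht
    have ht' : t ∈ Ioo 0 R := ⟨ht.1, ht.2.trans_le hr.2⟩
    obtain ⟨d, hd, he⟩ := hode t ht'
    have hy := hlt t (Ioo_subset_Icc_self ht')
    rw [ode_iff_mul_eq ht.1 hy] at he
    have hG := hasDerivAt_primitive_of_mem_Ioo
      ((hg.mono (Icc_subset_Icc_right ht'.2.le)).intervalIntegrable_of_Icc ht.1.le)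
      (hg.mono Ioo_subset_Icc_self) ht'
    exact (((hasDerivAt_id t).mul ((hasDerivAt_fSlope hy).comp t hd)).sub
      (hG.const_mul 2)).congr_deriv (sub_eq_zero.2 he)
  obtain ⟨c, -, hc⟩ := exists_hasDerivAt_eq_slope _ (fun _ => (0:ℝ)) hr0
    (hF.mono (Icc_subset_Icc_right hr.2)) hd
  have hc' : r * fSlope (v r) = 2 * ∫ s in (0:ℝ)..r, s * phiTrans lam (v s) := by
    field_simp at hc
    simp at hc
    linarith
  have : (2 / r) * ∫ s in (0:ℝ)..r, s * phiTrans lam (v s) = fSlope (v r) := by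
    rw [div_mul_eq_mul_div, ← hc']
    field_simp
  rw [this, fInv_fSlope (hlt r hr)]

lemma radial_ODE_of_eq_fInv {lam R : ℝ} {v : ℝ → ℝ}
    (hv : ContinuousOn v (Icc 0 R)) (hlt : ∀ r ∈ Icc 0 R, |v r| < 1)
    (heq : ∀ r ∈ Ioo 0 R,
      v r = fInv ((2 / r) * ∫ s in (0:ℝ)..r, s * phiTrans lam (v s)))
    {r : ℝ} (hr : r ∈ Ioo 0 R) :
    ∃ d2 : ℝ, HasDerivAt v d2 r ∧
      d2 / (1 - v r ^ 2) ^ ((3:ℝ)/2) + v r / (r * √(1 - v r ^ 2)) =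
        2 * (1 / √(1 - v r ^ 2) - lam) := by
  have hg := continuousOn_mul_phiTrans (lam := lam) hv hlt
  have hG := hasDerivAt_primitive_of_mem_Ioo
    ((hg.mono (Icc_subset_Icc_right hr.2.le)).intervalIntegrable_of_Icc hr.1.le)
    (hg.mono Ioo_subset_Icc_self) hr
  have hnhds : Ioo 0 R ∈ 𝓝 r := isOpen_Ioo.mem_nhds hr
  have hdiff : DifferentiableAt ℝ
      (fun t => fInv ((2 / t) * ∫ s in (0:ℝ)..t, s * phiTrans lam (v s))) r :=
    (differentiable_fInv _).comp r
      (((differentiableAt_const _).div differentiableAt_id hr.1.ne').mul hG.differentiableAt)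
  have hvd : HasDerivAt v _ r := hdiff.hasDerivAt.congr_of_eventuallyEq
    (eventually_of_mem hnhds heq)
  refine ⟨_, hvd, ?_⟩
  have hy := hlt r (Ioo_subset_Icc_self hr)
  rw [ode_iff_mul_eq hr.1 hy]
  refine ((hasDerivAt_id r).mul ((hasDerivAt_fSlope hy).comp r hvd)).unique
    ((hG.const_mul 2).congr_of_eventuallyEq (eventually_of_mem hnhds fun t ht => ?_))
  have ht0 := ht.1.ne'
  simp only [Pi.mul_apply, Function.comp, id]
  rw [heq t ht, fSlope_fInv]
  field_simp

lemma eq_of_eq_integral_of_hasDerivWithinAt {R : ℝ} {u v h : ℝ → ℝ}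
    (hu : ∀ r ∈ Icc 0 R, HasDerivWithinAt u (v r) (Icc 0 R) r)
    (hh : ContinuousOn h (Ioo 0 R)) (hb : ∀ t, |h t| ≤ 1)
    (heq : ∀ r ∈ Icc 0 R, u r = ∫ t in (0:ℝ)..r, h t) {r : ℝ} (hr : r ∈ Ioo 0 R) :
    v r = h r := by
  have hi : IntervalIntegrable h volume 0 r := by
    rw [intervalIntegrable_iff_integrableOn_Ioo_of_le hr.1.le]
    exact Integrable.of_bound
      ((hh.mono (Ioo_subset_Ioo_right hr.2.le)).aestronglyMeasurable measurableSet_Ioo) 1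
      (ae_of_all _ hb)
  have h1 : HasDerivAt u (v r) r :=
    (hu r (Ioo_subset_Icc_self hr)).hasDerivAt (Icc_mem_nhds hr.1 hr.2)
  exact h1.unique ((hasDerivAt_primitive_of_mem_Ioo hi hh hr).congr_of_eventuallyEq
    (eventually_of_mem (Icc_mem_nhds hr.1 hr.2) heq))

/-- The singular radial λ-translator ODE with `u(0) = u'(0) = 0` is equivalent to the
fixed-point integral equation
`u(r) = ∫₀^r f⁻¹((2/t) ∫₀^t s φ(u'(s)) ds) dt`. -/
theorem radial_ODE_iff_integral_equation
    (lam R : ℝ) (hlam : 0 < lam) (hR : 0 < R) (u u' : ℝ → ℝ)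
    (hu : ∀ r ∈ Icc (0:ℝ) R, HasDerivWithinAt u (u' r) (Icc (0:ℝ) R) r)
    (hu' : ContinuousOn u' (Icc (0:ℝ) R))
    (h0 : u 0 = 0) (h0' : u' 0 = 0)
    (hlt : ∀ r ∈ Icc (0:ℝ) R, |u' r| < 1) :
    (∀ r ∈ Ioo (0:ℝ) R, ∃ d2 : ℝ,
      HasDerivAt u' d2 r ∧
      d2 / (1 - u' r ^ 2) ^ ((3:ℝ)/2) + u' r / (r * Real.sqrt (1 - u' r ^ 2)) =
        2 * (1 / Real.sqrt (1 - u' r ^ 2) - lam)) ↔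
    (∀ r ∈ Icc (0:ℝ) R,
      u r = ∫ t in (0:ℝ)..r,
        fInv ((2 / t) * ∫ s in (0:ℝ)..t, s * phiTrans lam (u' s))) := by
  constructor
  · intro hode r hr
    have hsub : Icc 0 r ⊆ Icc 0 R := Icc_subset_Icc_right hr.2
    have hftc : ∫ t in (0:ℝ)..r, u' t = u r - u 0 :=
      integral_eq_sub_of_hasDerivAt_of_le hr.1
        (fun t ht => ((hu t (hsub ht)).mono hsub).continuousWithinAt)
        (fun t ht => (hu t (hsub (Ioo_subset_Icc_self ht))).hasDerivAt
          (Icc_mem_nhds ht.1 (ht.2.trans_le hr.2)))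
        ((hu'.mono hsub).intervalIntegrable_of_Icc hr.1)
    rw [h0, sub_zero] at hftc
    rw [← hftc]
    refine integral_congr fun t ht => ?_
    rw [uIcc_of_le hr.1] at ht
    exact eq_fInv_of_radial_ODE hR hu' hlt h0' hode (hsub ht)
  · intro hint r hr
    refine radial_ODE_of_eq_fInv hu' hlt (fun t ht => ?_) hr
    have hG := continuousOn_primitive_Icc hR.le (continuousOn_mul_phiTrans (lam := lam) hu' hlt)
    refine eq_of_eq_integral_of_hasDerivWithinAt hu ?_ (fun _ => abs_fInv_le_one _) hint ht
    exact differentiable_fInv.continuous.comp_continuousOn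
      ((continuousOn_const.div continuousOn_id fun t ht => ht.1.ne').mul
        (hG.mono Ioo_subset_Icc_self))
end
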